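/- Let n be odd and let A_1, A_2, …, A_n be n×n matrices over a field F. Then Σ_{ρ,σ ∈ Sym(n)^n, ρ_1 = id} ε(σ_1) · (∏_{i=1}^n ε(σ_i)) · (∏_{j=1}^n ε(ρ_j)) · ∏_{i=1}^n ∏_{j=1}^n (A_j)_{σ_i(j), ρ_j(i)} = (n−1)! · (R_n^E − R_n^O) · per(A_1) · ∏_{j=2}^n det(A_j), where the sum is over all n-tuples ρ = (ρ_1,…,ρ_n) and σ = (σ_1,…,σ_n) of permutations in Sym(n) with ρ_1 the identity, and the integer (n−1)!·(R_n^E − R_n^O) is cast into F. -/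

import Mathlib

/-- `L` is a Latin square of order `n`: every row and every column is a
bijection of `Fin n` (i.e. contains each symbol exactly once). -/
def IsLatin {n : ℕ} (L : Fin n → Fin n → Fin n) : Prop :=
  (∀ i, Function.Bijective fun j => L i j) ∧ ∀ j, Function.Bijective fun i => L i j

/-- The permutation determined by a bijective function (junk value `1` otherwise). -/
noncomputable def permOf {n : ℕ} (f : Fin n → Fin n) : Equiv.Perm (Fin n) :=
  if h : Function.Bijective f then Equiv.ofBijective f h else 1

/-- The product of the signs of the rows of `L`. -/
noncomputable def rowSign {n : ℕ} (L : Fin n → Fin n → Fin n) : ℤ :=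
  ∏ i, (Equiv.Perm.sign (permOf fun j => L i j) : ℤ)

/-- The product of the signs of the columns of `L`. -/
noncomputable def colSign {n : ℕ} (L : Fin n → Fin n → Fin n) : ℤ :=
  ∏ j, (Equiv.Perm.sign (permOf fun i => L i j) : ℤ)

/-- The sign of a Latin square: row-sign times column-sign. -/
noncomputable def latinSign {n : ℕ} (L : Fin n → Fin n → Fin n) : ℤ :=
  rowSign L * colSign L

/-- The permutation `α_s` of a Latin square `L`: `α_s i = j` iff `L i j = s`. -/
noncomputable def symPerm {n : ℕ} (L : Fin n → Fin n → Fin n) (s : Fin n) :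
    Equiv.Perm (Fin n) :=
  permOf fun i => (permOf fun j => L i j).symm s

/-- The symbol-sign of a Latin square: the product of the signs of the `α_s`. -/
noncomputable def symbolSign {n : ℕ} (L : Fin n → Fin n → Fin n) : ℤ :=
  ∏ s, (Equiv.Perm.sign (symPerm L s) : ℤ)

/-- The number of Latin squares of order `n`. -/
noncomputable def numLatin (n : ℕ) : ℕ :=
  Nat.card {L : Fin n → Fin n → Fin n // IsLatin L}

/-- The number of even Latin squares of order `n`. -/
noncomputable def numLatinEven (n : ℕ) : ℕ :=
  Nat.card {L : Fin n → Fin n → Fin n // IsLatin L ∧ latinSign L = 1}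

/-- The number of odd Latin squares of order `n`. -/
noncomputable def numLatinOdd (n : ℕ) : ℕ :=
  Nat.card {L : Fin n → Fin n → Fin n // IsLatin L ∧ latinSign L = -1}

/-- `L` is normalized: its first row is the identity permutation. -/
def IsNormalized {n : ℕ} (L : Fin n → Fin n → Fin n) : Prop :=
  ∀ j : Fin n, L ⟨0, j.pos⟩ j = j

/-- `L` is unipotent: all entries on the main diagonal are equal. -/
def IsUnipotent {n : ℕ} (L : Fin n → Fin n → Fin n) : Prop :=
  ∀ i k : Fin n, L i i = L k k

/-- The Alon-Tarsi constant `AT(n) = U_n^E - U_n^O`. -/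
noncomputable def AT (n : ℕ) : ℤ :=
  (Nat.card {L : Fin n → Fin n → Fin n //
      IsLatin L ∧ IsNormalized L ∧ IsUnipotent L ∧ latinSign L = 1} : ℤ) -
  (Nat.card {L : Fin n → Fin n → Fin n //
      IsLatin L ∧ IsNormalized L ∧ IsUnipotent L ∧ latinSign L = -1} : ℤ)

/-- `L` is reduced: first row and first column are the identity. -/
def IsReducedLatin {n : ℕ} (L : Fin n → Fin n → Fin n) : Prop :=
  IsNormalized L ∧ ∀ i : Fin n, L i ⟨0, i.pos⟩ = i

/-- The number of even reduced Latin squares of order `n`. -/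
noncomputable def numReducedEven (n : ℕ) : ℕ :=
  Nat.card {L : Fin n → Fin n → Fin n // IsLatin L ∧ IsReducedLatin L ∧ latinSign L = 1}

/-- The number of odd reduced Latin squares of order `n`. -/
noncomputable def numReducedOdd (n : ℕ) : ℕ :=
  Nat.card {L : Fin n → Fin n → Fin n // IsLatin L ∧ IsReducedLatin L ∧ latinSign L = -1}

/-- `L_n^SE(π)`: Latin squares whose permutation `α₁` (of the first symbol)
is `π` and whose symbol-sign is `+1`. The first symbol is the element of
`Fin n` with value `0`, and `α₁ = π` is expressed by `L i (π i) = first symbol`. -/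
noncomputable def numSymEven (n : ℕ) (π : Equiv.Perm (Fin n)) : ℕ :=
  Nat.card {L : Fin n → Fin n → Fin n //
    IsLatin L ∧ (∀ i, (L i (π i)).val = 0) ∧ symbolSign L = 1}

/-- `L_n^SO(π)`: as `numSymEven` but with symbol-sign `-1`. -/
noncomputable def numSymOdd (n : ℕ) (π : Equiv.Perm (Fin n)) : ℕ :=
  Nat.card {L : Fin n → Fin n → Fin n //
    IsLatin L ∧ (∀ i, (L i (π i)).val = 0) ∧ symbolSign L = -1}

/-- `L_n^CE(π)`: column-even Latin squares with first column `π`. -/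
noncomputable def numColEven (n : ℕ) (π : Equiv.Perm (Fin n)) : ℕ :=
  Nat.card {L : Fin n → Fin n → Fin n //
    IsLatin L ∧ (∀ i : Fin n, L i ⟨0, i.pos⟩ = π i) ∧ colSign L = 1}

/-- `L_n^CO(π)`: column-odd Latin squares with first column `π`. -/
noncomputable def numColOdd (n : ℕ) (π : Equiv.Perm (Fin n)) : ℕ :=
  Nat.card {L : Fin n → Fin n → Fin n //
    IsLatin L ∧ (∀ i : Fin n, L i ⟨0, i.pos⟩ = π i) ∧ colSign L = -1}

/-- `L_n^CE(α, β)`: column-even Latin squares with first row `α` and first column `β`. -/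
noncomputable def numColEven₂ (n : ℕ) (α β : Equiv.Perm (Fin n)) : ℕ :=
  Nat.card {L : Fin n → Fin n → Fin n //
    IsLatin L ∧ (∀ j : Fin n, L ⟨0, j.pos⟩ j = α j) ∧
      (∀ i : Fin n, L i ⟨0, i.pos⟩ = β i) ∧ colSign L = 1}

/-- `L_n^CO(α, β)`: column-odd Latin squares with first row `α` and first column `β`. -/
noncomputable def numColOdd₂ (n : ℕ) (α β : Equiv.Perm (Fin n)) : ℕ :=
  Nat.card {L : Fin n → Fin n → Fin n //
    IsLatin L ∧ (∀ j : Fin n, L ⟨0, j.pos⟩ j = α j) ∧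
      (∀ i : Fin n, L i ⟨0, i.pos⟩ = β i) ∧ colSign L = -1}

/-- The `n × n` matrix of indeterminates, over `ℤ`. -/
noncomputable def Xmat (n : ℕ) :
    Matrix (Fin n) (Fin n) (MvPolynomial (Fin n × Fin n) ℤ) :=
  Matrix.of fun i j => MvPolynomial.X (i, j)

/-- The exponent vector of the square-free monomial `∏_{i,j} X i j`. -/
noncomputable def allOnes (n : ℕ) : (Fin n × Fin n) →₀ ℕ :=
  Finsupp.equivFunOnFinite.symm fun _ => 1

/-- The `(0,1)`-matrix (over `ℤ`) associated to a Boolean matrix. -/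
def toInt {n : ℕ} (A : Fin n → Fin n → Bool) : Matrix (Fin n) (Fin n) ℤ :=
  Matrix.of fun i j => if A i j then 1 else 0

/-- `σ₀(A)`: the number of zero entries of a `(0,1)`-matrix. -/
def sigma0 {n : ℕ} (A : Fin n → Fin n → Bool) : ℕ :=
  (Finset.univ.filter fun p : Fin n × Fin n => A p.1 p.2 = false).card

theorem permOf_apply {n : ℕ} {f : Fin n → Fin n} (h : Function.Bijective f) (x : Fin n) :
    permOf f x = f x := by
  rw [permOf, dif_pos h, Equiv.ofBijective_apply]

theorem permOf_coe {n : ℕ} (e : Equiv.Perm (Fin n)) : permOf (fun x => e x) = e :=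
  Equiv.ext fun x => permOf_apply e.bijective x

/-- The signed sum over the column permutations of a matrix whose rows are selected by `g`. -/
theorem sum_sign_mul_prod_eq_det_submatrix {n : ℕ} {F : Type*} [CommRing F]
    (M : Matrix (Fin n) (Fin n) F) (g : Fin n → Fin n) :
    ∑ τ : Equiv.Perm (Fin n), ((Equiv.Perm.sign τ : ℤ) : F) * ∏ i, M (g i) (τ i) =
      (M.submatrix g id).det := by
  rw [← Matrix.det_transpose, Matrix.det_apply']
  rfl

theorem det_submatrix_of_bijective {n : ℕ} {F : Type*} [CommRing F]
    (M : Matrix (Fin n) (Fin n) F) {g : Fin n → Fin n} (hg : Function.Bijective g) :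
    (M.submatrix g id).det = ((Equiv.Perm.sign (permOf g) : ℤ) : F) * M.det := by
  rw [← Matrix.det_permute]
  congr
  ext i
  rw [permOf_apply hg]

theorem det_submatrix_of_not_bijective {n : ℕ} {F : Type*} [CommRing F]
    (M : Matrix (Fin n) (Fin n) F) {g : Fin n → Fin n} (hg : ¬ Function.Bijective g) :
    (M.submatrix g id).det = 0 := by
  rw [← Finite.injective_iff_bijective, Function.Injective] at hg
  push Not at hg
  obtain ⟨a, b, hab, hne⟩ := hg
  exact Matrix.det_zero_of_row_eq hne (by ext j; simp [hab])

/-- If all rows are permutations and all columns but one are bijective, so is the last column. -/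
theorem bijective_column_of_forall_ne {n : ℕ} (z : Fin n) (σ : Fin n → Equiv.Perm (Fin n))
    (h : ∀ j ≠ z, Function.Bijective fun i => σ i j) : Function.Bijective fun i => σ i z := by
  rw [← Finite.surjective_iff_bijective]
  intro s
  by_contra! hs
  have hmaps : ∀ i ∈ (Finset.univ : Finset (Fin n)), (σ i).symm s ∈ Finset.univ.erase z := by
    intro i _
    simp only [Finset.mem_erase, Finset.mem_univ, and_true]
    intro he
    exact hs i (by simp [← he])
  have hcard : (Finset.univ.erase z).card < (Finset.univ : Finset (Fin n)).card :=
    Finset.card_lt_card (Finset.erase_ssubset (Finset.mem_univ z))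
  obtain ⟨a, -, b, -, hne, hab⟩ := Finset.exists_ne_map_eq_of_card_lt_of_maps_to hcard hmaps
  refine hne ((h _ (Finset.ne_of_mem_erase (hmaps a (Finset.mem_univ a)))).1 ?_)
  simp only [Equiv.apply_symm_apply]
  rw [hab, Equiv.apply_symm_apply]

/-- A sum over tuples with one prescribed coordinate factors. -/
theorem sum_filter_prod_eq {ι κ F : Type*} [Fintype ι] [DecidableEq ι] [Fintype κ]
    [DecidableEq κ] [CommRing F] (z : ι) (a : κ) (f : ι → κ → F) :
    ∑ ρ ∈ Finset.univ.filter (fun ρ : ι → κ => ρ z = a), ∏ j, f j (ρ j) =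
      f z a * ∏ j ∈ Finset.univ.erase z, ∑ k, f j k := by
  have hset : Finset.univ.filter (fun ρ : ι → κ => ρ z = a) =
      Fintype.piFinset fun j => if j = z then {a} else Finset.univ := by
    ext ρ
    simp only [Finset.mem_filter, Finset.mem_univ, true_and, Fintype.mem_piFinset]
    constructor
    · intro h j
      split_ifs with hj
      · simp [hj, h]
      · simp
    · intro h
      simpa using h z
  rw [hset, ← Finset.prod_univ_sum, ← Finset.mul_prod_erase _ _ (Finset.mem_univ z)]
  congr 1
  · simp
  · refine Finset.prod_congr rfl fun j hj => ?_
    rw [if_neg (Finset.ne_of_mem_erase hj)]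

theorem card_perm_fixing {n : ℕ} (hn : 0 < n) :
    (Finset.univ.filter fun α : Equiv.Perm (Fin n) => α ⟨0, hn⟩ = ⟨0, hn⟩).card =
      (n - 1).factorial := by
  obtain _ | m := n
  · omega
  have hset : (Finset.univ.filter fun α : Equiv.Perm (Fin (m + 1)) => α ⟨0, hn⟩ = ⟨0, hn⟩) =
      Finset.univ.image fun e : Equiv.Perm (Fin m) => Equiv.Perm.decomposeFin.symm (0, e) := by
    ext α
    simp only [Finset.mem_filter, Finset.mem_univ, true_and, Finset.mem_image]
    constructor
    · intro h
      refine ⟨(Equiv.Perm.decomposeFin α).2, ?_⟩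
      rw [Equiv.symm_apply_eq]
      refine Prod.ext ?_ rfl
      have h0 := Equiv.Perm.decomposeFin_symm_apply_zero (Equiv.Perm.decomposeFin α).1
        (Equiv.Perm.decomposeFin α).2
      rw [Prod.mk.eta, Equiv.symm_apply_apply] at h0
      exact h.symm.trans h0
    · rintro ⟨e, rfl⟩
      exact Equiv.Perm.decomposeFin_symm_apply_zero 0 e
  rw [hset, Finset.card_image_of_injective _ fun a b h => by simpa using h]
  simp [Fintype.card_perm]

/-- Relabel the symbols of `L` by `π` and permute its columns by `α`. -/
def isotope {n : ℕ} (π α : Equiv.Perm (Fin n)) (L : Fin n → Fin n → Fin n) :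
    Fin n → Fin n → Fin n :=
  fun i j => π (L i (α j))

theorem IsLatin.isotope {n : ℕ} {L : Fin n → Fin n → Fin n} (hL : IsLatin L)
    (π α : Equiv.Perm (Fin n)) : IsLatin (isotope π α L) :=
  ⟨fun i => π.bijective.comp ((hL.1 i).comp α.bijective),
    fun j => π.bijective.comp (hL.2 (α j))⟩

theorem permOf_row_isotope {n : ℕ} {L : Fin n → Fin n → Fin n} (hL : IsLatin L)
    (π α : Equiv.Perm (Fin n)) (i : Fin n) :
    permOf (fun j => isotope π α L i j) = π * permOf (fun j => L i j) * α := by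
  ext1 j
  rw [permOf_apply ((hL.isotope π α).1 i)]
  simp [permOf_apply (hL.1 i), isotope]

theorem permOf_col_isotope {n : ℕ} {L : Fin n → Fin n → Fin n} (hL : IsLatin L)
    (π α : Equiv.Perm (Fin n)) (j : Fin n) :
    permOf (fun i => isotope π α L i j) = π * permOf (fun i => L i (α j)) := by
  ext1 i
  rw [permOf_apply ((hL.isotope π α).2 j)]
  simp [permOf_apply (hL.2 (α j)), isotope]

theorem sign_mul_self_int {n : ℕ} (π : Equiv.Perm (Fin n)) :
    (Equiv.Perm.sign π : ℤ) * (Equiv.Perm.sign π : ℤ) = 1 := by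
  rw [← Units.val_mul, Int.units_mul_self, Units.val_one]

theorem sign_pow_odd {n m : ℕ} (hm : Odd m) (π : Equiv.Perm (Fin n)) :
    (Equiv.Perm.sign π : ℤ) ^ m = (Equiv.Perm.sign π : ℤ) := by
  rcases Int.units_eq_one_or (Equiv.Perm.sign π) with h | h <;> simp [h, hm.neg_one_pow]

theorem latinSign_isotope {n : ℕ} (hn : Odd n) {L : Fin n → Fin n → Fin n} (hL : IsLatin L)
    (π α : Equiv.Perm (Fin n)) :
    latinSign (isotope π α L) = (Equiv.Perm.sign α : ℤ) * latinSign L := by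
  have hcol : ∏ j, (Equiv.Perm.sign (permOf fun i => L i (α j)) : ℤ) =
      ∏ j, (Equiv.Perm.sign (permOf fun i => L i j) : ℤ) :=
    Equiv.prod_comp α fun j => (Equiv.Perm.sign (permOf fun i => L i j) : ℤ)
  simp only [latinSign, rowSign, colSign, permOf_row_isotope hL, permOf_col_isotope hL,
    Equiv.Perm.sign_mul, Units.val_mul, Finset.prod_mul_distrib, Finset.prod_const,
    Finset.card_univ, Fintype.card_fin, sign_pow_odd hn, hcol]
  linear_combination ((∏ i, (Equiv.Perm.sign (permOf fun j => L i j) : ℤ)) *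
    (Equiv.Perm.sign α : ℤ) * ∏ j, (Equiv.Perm.sign (permOf fun i => L i j) : ℤ)) *
    sign_mul_self_int π

theorem latinSign_eq_one_or {n : ℕ} (L : Fin n → Fin n → Fin n) :
    latinSign L = 1 ∨ latinSign L = -1 := by
  rw [← Int.isUnit_iff]
  simp only [latinSign, rowSign, colSign, ← Units.coe_prod, ← Units.val_mul]
  exact Units.isUnit _

open Classical in
theorem sum_latinSign_reduced (n : ℕ) :
    ∑ L ∈ Finset.univ.filter
        (fun L : Fin n → Fin n → Fin n => IsLatin L ∧ IsReducedLatin L), latinSign L =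
      (numReducedEven n : ℤ) - numReducedOdd n := by
  simp only [numReducedEven, numReducedOdd, Nat.card_eq_fintype_card, Fintype.card_subtype,
    ← and_assoc]
  rw [← Finset.filter_filter _ (fun L => latinSign L = 1),
    ← Finset.filter_filter _ (fun L => latinSign L = -1), Finset.card_filter, Finset.card_filter]
  push_cast
  rw [← Finset.sum_sub_distrib]
  refine Finset.sum_congr rfl fun L _ => ?_
  rcases latinSign_eq_one_or L with h | h <;> simp [h]

/-- Every Latin square is uniquely an isotope of a reduced one by a relabelling `π` of the symbols
and a column permutation `α` fixing the first column. -/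
theorem sum_isLatin_eq_sum_reduced {n : ℕ} (hn : 0 < n) {F : Type*} [CommRing F]
    [DecidablePred fun L : Fin n → Fin n → Fin n => IsLatin L]
    [DecidablePred fun L : Fin n → Fin n → Fin n => IsLatin L ∧ IsReducedLatin L]
    (f : (Fin n → Fin n → Fin n) → F) :
    ∑ σ ∈ Finset.univ.filter
        (fun σ : Fin n → Equiv.Perm (Fin n) => IsLatin fun i j => σ i j), f (fun i j => σ i j) =
      ∑ π : Equiv.Perm (Fin n),
        ∑ α ∈ Finset.univ.filter
          (fun α : Equiv.Perm (Fin n) => α ⟨0, hn⟩ = ⟨0, hn⟩),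
          ∑ L ∈ Finset.univ.filter
            (fun L : Fin n → Fin n → Fin n => IsLatin L ∧ IsReducedLatin L),
            f (isotope π α L) := by
  simp only [← Finset.sum_product']
  symm
  refine Finset.sum_bij'
    (fun p _ => fun i => permOf fun j => isotope p.1 p.2.1 p.2.2 i j)
    (fun σ _ => (permOf fun i => σ i ⟨0, hn⟩, (permOf fun i => σ i ⟨0, hn⟩)⁻¹ * σ ⟨0, hn⟩,
      isotope (permOf fun i => σ i ⟨0, hn⟩)⁻¹
        ((permOf fun i => σ i ⟨0, hn⟩)⁻¹ * σ ⟨0, hn⟩)⁻¹ fun i j => σ i j)) ?_ ?_ ?_ ?_ ?_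
  · rintro ⟨π, α, L⟩ hp
    simp only [Finset.mem_product, Finset.mem_filter, Finset.mem_univ, true_and] at hp ⊢
    simp only [permOf_apply ((hp.2.1.isotope π α).1 _)]
    exact hp.2.1.isotope π α
  · intro σ hσ
    simp only [Finset.mem_product, Finset.mem_filter, Finset.mem_univ, true_and] at hσ ⊢
    have hπ : ∀ i, permOf (fun i => σ i ⟨0, hn⟩) i = σ i ⟨0, hn⟩ := permOf_apply (hσ.2 _)
    generalize permOf (fun i => σ i ⟨0, hn⟩) = π at hπ
    have hα : π⁻¹ (σ ⟨0, hn⟩ ⟨0, hn⟩) = ⟨0, hn⟩ := by rw [← hπ]; simp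
    refine ⟨by simpa using hα, hσ.isotope _ _, fun j => ?_, fun i => ?_⟩
    · simp [isotope]
    · have h0 : (π⁻¹ * σ ⟨0, hn⟩)⁻¹ ⟨0, hn⟩ = ⟨0, hn⟩ := by
        rw [Equiv.Perm.inv_eq_iff_eq]
        simpa using hα.symm
      simp only [isotope]
      rw [h0, ← hπ]
      simp
  · rintro ⟨π, α, L⟩ hp
    simp only [Finset.mem_product, Finset.mem_filter, Finset.mem_univ, true_and] at hp
    obtain ⟨hα, hL, hrow, hcol⟩ := hp
    have hπ : (permOf fun i => isotope π α L i ⟨0, hn⟩) = π := by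
      ext1 i
      rw [permOf_apply ((hL.isotope π α).2 _), isotope, hα]
      exact congrArg π (hcol i)
    have hα' : π⁻¹ * (permOf fun j => isotope π α L ⟨0, hn⟩ j) = α := by
      ext1 j
      rw [Equiv.Perm.mul_apply, permOf_apply ((hL.isotope π α).1 _), isotope,
        Equiv.Perm.inv_def, Equiv.symm_apply_apply]
      exact hrow _
    simp only [permOf_apply ((hL.isotope π α).1 _), hπ, hα']
    refine Prod.ext rfl (Prod.ext rfl ?_)
    ext1 i
    ext1 j
    simp [isotope]
  · intro σ hσ
    ext1 i
    simp [isotope, permOf_coe]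
  · rintro ⟨π, α, L⟩ hp
    simp only [Finset.mem_product, Finset.mem_filter, Finset.mem_univ, true_and] at hp
    simp only [permOf_apply ((hp.2.1.isotope π α).1 _)]

/-- Summing out the free column permutations leaves a product of determinants. -/
theorem sum_perm_products_eq_sum_det {n : ℕ} {F : Type*} [CommRing F] (z : Fin n)
    (A : Fin n → Matrix (Fin n) (Fin n) F) (σ : Fin n → Equiv.Perm (Fin n)) :
    ∑ ρ ∈ Finset.univ.filter (fun ρ : Fin n → Equiv.Perm (Fin n) => ρ z = 1),
        ((∏ j, ((Equiv.Perm.sign (ρ j) : ℤ) : F)) * ∏ i, ∏ j, A j (σ i j) (ρ j i)) =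
      (∏ i, A z (σ i z) i) *
        ∏ j ∈ Finset.univ.erase z, ((A j).submatrix (fun i => σ i j) id).det := by
  have h := sum_filter_prod_eq z (1 : Equiv.Perm (Fin n)) fun j τ =>
    ((Equiv.Perm.sign τ : ℤ) : F) * ∏ i, A j (σ i j) (τ i)
  simp only [Equiv.Perm.sign_one, Units.val_one, Int.cast_one, one_mul, Equiv.Perm.one_apply,
    Finset.prod_mul_distrib] at h
  simp only [← sum_sign_mul_prod_eq_det_submatrix]
  rw [← h]
  exact Finset.sum_congr rfl fun ρ _ => by rw [Finset.prod_comm]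

theorem prod_det_submatrix_of_isLatin {n : ℕ} {F : Type*} [CommRing F] (z : Fin n)
    (A : Fin n → Matrix (Fin n) (Fin n) F) {L : Fin n → Fin n → Fin n} (hL : IsLatin L) :
    ∏ j ∈ Finset.univ.erase z, ((A j).submatrix (fun i => L i j) id).det =
      (((Equiv.Perm.sign (permOf fun i => L i z) : ℤ) * colSign L : ℤ) : F) *
        ∏ j ∈ Finset.univ.erase z, (A j).det := by
  rw [Finset.prod_congr rfl fun j _ => det_submatrix_of_bijective (A j) (hL.2 j),
    Finset.prod_mul_distrib, colSign, ← Finset.mul_prod_erase _ _ (Finset.mem_univ z),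
    ← mul_assoc, sign_mul_self_int, one_mul]
  push_cast
  rfl

theorem prod_det_submatrix_of_not_isLatin {n : ℕ} {F : Type*} [CommRing F] (z : Fin n)
    (A : Fin n → Matrix (Fin n) (Fin n) F) {σ : Fin n → Equiv.Perm (Fin n)}
    (hσ : ¬ IsLatin fun i j => σ i j) :
    ∏ j ∈ Finset.univ.erase z, ((A j).submatrix (fun i => σ i j) id).det = 0 := by
  have hex : ∃ j ≠ z, ¬ Function.Bijective fun i => σ i j := by
    by_contra! h
    refine hσ ⟨fun i => (σ i).bijective, fun j => ?_⟩
    by_cases hj : j = z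
    · exact hj ▸ bijective_column_of_forall_ne z σ h
    · exact h j hj
  obtain ⟨j, hj, hbij⟩ := hex
  exact Finset.prod_eq_zero (Finset.mem_erase.2 ⟨hj, Finset.mem_univ j⟩)
    (det_submatrix_of_not_bijective (A j) hbij)

/-- For odd `n` and `n × n` matrices `A 0, …, A (n-1)` over a field,
`∑_{ρ,σ, ρ₁ = id} ε(σ₁) (∏ᵢ ε(σᵢ)) (∏ⱼ ε(ρⱼ)) ∏_{i,j} (A j) (σᵢ j) (ρⱼ i)
  = (n-1)! (R_n^E - R_n^O) per(A 1) ∏_{j ≠ 1} det(A j)`. -/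
theorem sum_perm_products_eq (n : ℕ) (hn : Odd n) (F : Type*) [Field F]
    (A : Fin n → Matrix (Fin n) (Fin n) F) :
    ∑ ρ ∈ Finset.univ.filter
        (fun ρ : Fin n → Equiv.Perm (Fin n) => ρ ⟨0, hn.pos⟩ = 1),
      ∑ σ : Fin n → Equiv.Perm (Fin n),
        ((Equiv.Perm.sign (σ ⟨0, hn.pos⟩) : ℤ) : F) *
          (∏ i, ((Equiv.Perm.sign (σ i) : ℤ) : F)) *
          (∏ j, ((Equiv.Perm.sign (ρ j) : ℤ) : F)) *
          ∏ i, ∏ j, A j (σ i j) (ρ j i)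
      = ((((n - 1).factorial : ℤ) * ((numReducedEven n : ℤ) - numReducedOdd n) : ℤ) : F) *
          (A ⟨0, hn.pos⟩).permanent *
          ∏ j ∈ Finset.univ.erase (⟨0, hn.pos⟩ : Fin n), (A j).det := by
  classical
  have hsum : ∀ σ : Fin n → Equiv.Perm (Fin n),
      (∑ ρ ∈ Finset.univ.filter
          (fun ρ : Fin n → Equiv.Perm (Fin n) => ρ ⟨0, hn.pos⟩ = 1),
        ((Equiv.Perm.sign (σ ⟨0, hn.pos⟩) : ℤ) : F) *
          (∏ i, ((Equiv.Perm.sign (σ i) : ℤ) : F)) *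
          (∏ j, ((Equiv.Perm.sign (ρ j) : ℤ) : F)) *
          ∏ i, ∏ j, A j (σ i j) (ρ j i)) =
        if IsLatin (fun i j => σ i j) then
          (((Equiv.Perm.sign (permOf fun j => σ ⟨0, hn.pos⟩ j) : ℤ) *
            (Equiv.Perm.sign (permOf fun i => σ i ⟨0, hn.pos⟩) : ℤ) *
            latinSign (fun i j => σ i j) : ℤ) : F) * (∏ i, A ⟨0, hn.pos⟩ (σ i ⟨0, hn.pos⟩) i) *
            ∏ j ∈ Finset.univ.erase (⟨0, hn.pos⟩ : Fin n), (A j).det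
        else 0 := by
    intro σ
    simp only [mul_assoc]
    rw [← Finset.mul_sum, ← Finset.mul_sum, sum_perm_products_eq_sum_det]
    split_ifs with hσ
    · rw [prod_det_submatrix_of_isLatin _ A hσ]
      simp only [latinSign, rowSign, permOf_coe]
      push_cast
      ring
    · rw [prod_det_submatrix_of_not_isLatin _ A hσ]
      simp
  have hterm : ∀ π : Equiv.Perm (Fin n), ∀ α ∈ Finset.univ.filter
      (fun α : Equiv.Perm (Fin n) => α ⟨0, hn.pos⟩ = ⟨0, hn.pos⟩),
      ∀ L ∈ Finset.univ.filter
        (fun L : Fin n → Fin n → Fin n => IsLatin L ∧ IsReducedLatin L),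
      (((Equiv.Perm.sign (permOf fun j => isotope π α L ⟨0, hn.pos⟩ j) : ℤ) *
        (Equiv.Perm.sign (permOf fun i => isotope π α L i ⟨0, hn.pos⟩) : ℤ) *
        latinSign (isotope π α L) : ℤ) : F) *
        (∏ i, A ⟨0, hn.pos⟩ (isotope π α L i ⟨0, hn.pos⟩) i) *
        ∏ j ∈ Finset.univ.erase (⟨0, hn.pos⟩ : Fin n), (A j).det =
      (∏ i, A ⟨0, hn.pos⟩ (π i) i) * ((latinSign L : ℤ) : F) *
        ∏ j ∈ Finset.univ.erase (⟨0, hn.pos⟩ : Fin n), (A j).det := by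
    intro π α hα L hL
    simp only [Finset.mem_filter, Finset.mem_univ, true_and] at hα hL
    obtain ⟨hL, hrow, hcol⟩ := hL
    have hrow' : (permOf fun j => L ⟨0, hn.pos⟩ j) = 1 :=
      Equiv.ext fun j => (permOf_apply (hL.1 _) j).trans (hrow j)
    have hcol' : (permOf fun i => L i ⟨0, hn.pos⟩) = 1 :=
      Equiv.ext fun i => (permOf_apply (hL.2 _) i).trans (hcol i)
    have hiso : ∀ i, isotope π α L i ⟨0, hn.pos⟩ = π i := by
      intro i
      rw [isotope, hα]
      exact congrArg π (hcol i)
    have hsign : (Equiv.Perm.sign (permOf fun j => isotope π α L ⟨0, hn.pos⟩ j) : ℤ) *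
        (Equiv.Perm.sign (permOf fun i => isotope π α L i ⟨0, hn.pos⟩) : ℤ) *
        latinSign (isotope π α L) = latinSign L := by
      rw [permOf_row_isotope hL, permOf_col_isotope hL, hα, hrow', hcol',
        latinSign_isotope hn hL]
      simp only [mul_one, Equiv.Perm.sign_mul, Units.val_mul]
      linear_combination ((Equiv.Perm.sign π : ℤ) * (Equiv.Perm.sign π : ℤ) * latinSign L) *
        sign_mul_self_int α + latinSign L * sign_mul_self_int π
    rw [hsign]
    simp only [hiso]
    ring
  rw [Finset.sum_comm, Finset.sum_congr rfl fun σ _ => hsum σ, ← Finset.sum_filter,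
    sum_isLatin_eq_sum_reduced hn.pos fun L =>
      (((Equiv.Perm.sign (permOf fun j => L ⟨0, hn.pos⟩ j) : ℤ) *
        (Equiv.Perm.sign (permOf fun i => L i ⟨0, hn.pos⟩) : ℤ) * latinSign L : ℤ) : F) *
        (∏ i, A ⟨0, hn.pos⟩ (L i ⟨0, hn.pos⟩) i) *
        ∏ j ∈ Finset.univ.erase (⟨0, hn.pos⟩ : Fin n), (A j).det,
    Finset.sum_congr rfl fun π _ => Finset.sum_congr rfl fun α hα =>
      Finset.sum_congr rfl fun L hL => hterm π α hα L hL]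
  simp only [← Finset.sum_mul, ← Finset.mul_sum, Finset.sum_const, card_perm_fixing hn.pos,
    ← Int.cast_sum, sum_latinSign_reduced, nsmul_eq_mul, Matrix.permanent]
  push_cast
  ring
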